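/- arXiv:math/0403001 — 9 statements merged into one kernel-verified Lean document; each statement's English description precedes it below -/
import Mathlib

section
/- Let n ≥ 1, let β > 0, and let f : ℝⁿ × ℝ → ℝⁿ be continuous and continuously differentiable in its first argument, such that for all x ∈ ℝⁿ, t ∈ ℝ, and v ∈ ℝⁿ, the Jacobian J(x,t) = ∂f/∂x satisfies ⟨J(x,t)v, v⟩ ≤ −β‖v‖². If x, y : ℝ → ℝⁿ are differentiable with x'(t) = f(x(t),t) and y'(t) = f(y(t),t) for all t, then for all t ≥ t₀, ‖x(t) − y(t)‖ ≤ e^{−β(t−t₀)} ‖x(t₀) − y(t₀)‖. -/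
open scoped RealInnerProductSpace

section OneSidedLipschitz

variable {E : Type*} [NormedAddCommGroup E] [InnerProductSpace ℝ E]

/-- A differentiable vector field whose derivative has quadratic form bounded above by `c`
is one-sided Lipschitz with constant `c`. -/
theorem inner_sub_sub_le_of_inner_fderiv_le {g : E → E} {c : ℝ} (hg : Differentiable ℝ g)
    (h : ∀ x v : E, ⟪fderiv ℝ g x v, v⟫ ≤ c * ‖v‖ ^ 2) (a b : E) :
    ⟪g a - g b, a - b⟫ ≤ c * ‖a - b‖ ^ 2 := by
  have hφ : ∀ s : ℝ, HasDerivAt (fun s : ℝ => ⟪g (b + s • (a - b)), a - b⟫)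
      ⟪fderiv ℝ g (b + s • (a - b)) (a - b), a - b⟫ s := by
    intro s
    have hline : HasDerivAt (fun s : ℝ => b + s • (a - b)) (a - b) s := by
      simpa using ((hasDerivAt_id s).smul_const (a - b)).const_add b
    have hcomp := (hg (b + s • (a - b))).hasFDerivAt.comp_hasDerivAt s hline
    simpa using hcomp.inner ℝ (hasDerivAt_const s (a - b))
  obtain ⟨s, -, hs⟩ := exists_hasDerivAt_eq_slope _ _ zero_lt_one
    (fun s _ => (hφ s).continuousAt.continuousWithinAt) (fun s _ => hφ s)
  have hle := h (b + s • (a - b)) (a - b)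
  rw [hs] at hle
  simpa [inner_sub_left] using hle

/-- Two curves whose velocity difference satisfies a one-sided Lipschitz bound with constant `c`
separate at most at the exponential rate `c`. -/
theorem norm_sub_le_exp_mul_of_inner_deriv_sub_le {x y x' y' : ℝ → E} {c : ℝ}
    (hx : ∀ t, HasDerivAt x (x' t) t) (hy : ∀ t, HasDerivAt y (y' t) t)
    (h : ∀ t, ⟪x' t - y' t, x t - y t⟫ ≤ c * ‖x t - y t‖ ^ 2) {t₀ t : ℝ} (ht : t₀ ≤ t) :
    ‖x t - y t‖ ≤ Real.exp (c * (t - t₀)) * ‖x t₀ - y t₀‖ := by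
  have hderiv : ∀ s, HasDerivAt
      (fun s => Real.exp (-(2 * c) * (s - t₀)) * ‖x s - y s‖ ^ 2)
      (Real.exp (-(2 * c) * (s - t₀)) * (-(2 * c)) * ‖x s - y s‖ ^ 2 +
        Real.exp (-(2 * c) * (s - t₀)) * (2 * ⟪x s - y s, x' s - y' s⟫)) s := by
    intro s
    have hexp : HasDerivAt (fun s => Real.exp (-(2 * c) * (s - t₀)))
        (Real.exp (-(2 * c) * (s - t₀)) * (-(2 * c))) s := by
      simpa using (((hasDerivAt_id s).sub_const t₀).const_mul (-(2 * c))).exp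
    exact hexp.mul ((hx s).sub (hy s)).norm_sq
  have hanti : Antitone (fun s => Real.exp (-(2 * c) * (s - t₀)) * ‖x s - y s‖ ^ 2) := by
    refine antitone_of_hasDerivAt_nonpos hderiv fun s => ?_
    have hs := h s
    rw [real_inner_comm] at hs
    have := mul_le_mul_of_nonneg_left hs (Real.exp_pos (-(2 * c) * (s - t₀))).le
    simp only [Pi.zero_apply]
    linarith
  have hsq : Real.exp (-(2 * c) * (t - t₀)) * ‖x t - y t‖ ^ 2 ≤ ‖x t₀ - y t₀‖ ^ 2 := by
    simpa using hanti ht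
  refine (sq_le_sq₀ (norm_nonneg _) (by positivity)).1 ?_
  calc ‖x t - y t‖ ^ 2
      = Real.exp (c * (t - t₀)) ^ 2 *
          (Real.exp (-(2 * c) * (t - t₀)) * ‖x t - y t‖ ^ 2) := by
        rw [← mul_assoc, ← Real.exp_nat_mul, ← Real.exp_add]
        ring_nf
        simp
    _ ≤ Real.exp (c * (t - t₀)) ^ 2 * ‖x t₀ - y t₀‖ ^ 2 := by gcongr
    _ = (Real.exp (c * (t - t₀)) * ‖x t₀ - y t₀‖) ^ 2 := (mul_pow _ _ _).symm

end OneSidedLipschitz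

theorem contraction_identity_metric (n : ℕ) (hn : 1 ≤ n) (β : ℝ) (hβ : 0 < β)
    (f : EuclideanSpace ℝ (Fin n) → ℝ → EuclideanSpace ℝ (Fin n))
    (hf_cont : Continuous fun p : EuclideanSpace ℝ (Fin n) × ℝ => f p.1 p.2)
    (hf_diff : ∀ t : ℝ, ContDiff ℝ 1 fun x => f x t)
    (hJ : ∀ (x : EuclideanSpace ℝ (Fin n)) (t : ℝ) (v : EuclideanSpace ℝ (Fin n)),
      ⟪(fderiv ℝ (fun y => f y t) x) v, v⟫ ≤ -β * ‖v‖ ^ 2)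
    (x y : ℝ → EuclideanSpace ℝ (Fin n))
    (hx : Differentiable ℝ x) (hy : Differentiable ℝ y)
    (hx' : ∀ t : ℝ, deriv x t = f (x t) t)
    (hy' : ∀ t : ℝ, deriv y t = f (y t) t)
    (t₀ t : ℝ) (ht : t₀ ≤ t) :
    ‖x t - y t‖ ≤ Real.exp (-β * (t - t₀)) * ‖x t₀ - y t₀‖ := by
  refine norm_sub_le_exp_mul_of_inner_deriv_sub_le (fun s => (hx s).hasDerivAt)
    (fun s => (hy s).hasDerivAt) (fun s => ?_) ht
  rw [hx', hy']
  exact inner_sub_sub_le_of_inner_fderiv_le ((hf_diff s).differentiable one_ne_zero)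
    (fun z v => hJ z s v) (x s) (y s)
end

section
/- Let n ≥ 1 and let Θ₁, Θ₂, Θ₁d, Θ₂d, J be n×n real matrices with Θ₁ and Θ₂ invertible, such that Θ₁ᵀ·Θ₁ = Θ₂ᵀ·Θ₂ and Θ₁dᵀ·Θ₁ + Θ₁ᵀ·Θ₁d = Θ₂dᵀ·Θ₂ + Θ₂ᵀ·Θ₂d. For i = 1, 2 define Fᵢ = (Θᵢd + Θᵢ·J)·Θᵢ⁻¹ and its symmetric part F_s⁽ⁱ⁾ = (1/2)(Fᵢ + Fᵢᵀ). Then the matrix Q = Θ₂·Θ₁⁻¹ is orthogonal (QᵀQ = I) and F_s⁽²⁾ = Q · F_s⁽¹⁾ · Q⁻¹; in particular F_s⁽¹⁾ and F_s⁽²⁾ have the same characteristic polynomial. -/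
open Matrix

namespace Matrix

variable {m R : Type*} [Fintype m] [DecidableEq m] [CommRing R]

/-- Pulling the symmetrized generalized Jacobian back along `Θ` gives an expression in
`Θᵀ * Θ`, its derivative and `J` only. -/
theorem transpose_mul_generalizedJacobian_add_transpose_mul {Θ : Matrix m m R} (h : IsUnit Θ)
    (Θd J : Matrix m m R) :
    Θᵀ * ((Θd + Θ * J) * Θ⁻¹ + ((Θd + Θ * J) * Θ⁻¹)ᵀ) * Θ =
      (Θdᵀ * Θ + Θᵀ * Θd) + (Θᵀ * Θ * J + Jᵀ * (Θᵀ * Θ)) := by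
  have hdet : IsUnit Θ.det := (isUnit_iff_isUnit_det Θ).mp h
  have hF : (Θd + Θ * J) * Θ⁻¹ * Θ = Θd + Θ * J := nonsing_inv_mul_cancel_right _ _ hdet
  have hFt : Θᵀ * ((Θd + Θ * J) * Θ⁻¹)ᵀ = (Θd + Θ * J)ᵀ := by
    rw [← transpose_mul, hF]
  rw [mul_add, add_mul, hFt, mul_assoc, hF, transpose_add, transpose_mul]
  noncomm_ring

theorem transpose_mul_self_mul_inv {A B : Matrix m m R} (hA : IsUnit A)
    (h : Aᵀ * A = Bᵀ * B) : (B * A⁻¹)ᵀ * (B * A⁻¹) = 1 := by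
  have hdet : IsUnit A.det := (isUnit_iff_isUnit_det A).mp hA
  calc (B * A⁻¹)ᵀ * (B * A⁻¹) = A⁻¹ᵀ * (Bᵀ * B) * A⁻¹ := by
        simp only [transpose_mul, mul_assoc]
    _ = (A * A⁻¹)ᵀ * (A * A⁻¹) := by
        rw [← h]
        simp only [transpose_mul, mul_assoc]
    _ = 1 := by simp [mul_nonsing_inv A hdet]

/-- Orthogonally conjugate matrices are detected by their pullbacks. -/
theorem eq_conj_of_transpose_mul_mul_eq {A B S T : Matrix m m R} (hA : IsUnit A) (hB : IsUnit B)
    (hAB : Aᵀ * A = Bᵀ * B) (h : Aᵀ * S * A = Bᵀ * T * B) :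
    T = (B * A⁻¹) * S * (B * A⁻¹)⁻¹ := by
  have hdet : IsUnit A.det := (isUnit_iff_isUnit_det A).mp hA
  have hQ := transpose_mul_self_mul_inv hA hAB
  rw [inv_eq_left_inv hQ]
  set Q := B * A⁻¹ with hQ_def
  have hB_eq : Q * A = B := nonsing_inv_mul_cancel_right _ _ hdet
  have hA_eq : Qᵀ * B = A := by rw [← hB_eq, ← mul_assoc, hQ, one_mul]
  have hA_eq_transpose : Bᵀ * Q = Aᵀ := by rw [← hA_eq, transpose_mul, transpose_transpose]
  refine ((isUnit_transpose B).mpr hB).mul_left_cancel (hB.mul_right_cancel ?_)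
  calc Bᵀ * T * B = Aᵀ * S * A := h.symm
    _ = Bᵀ * Q * S * (Qᵀ * B) := by rw [hA_eq, hA_eq_transpose]
    _ = Bᵀ * (Q * S * Qᵀ) * B := by simp only [mul_assoc]

end Matrix

theorem same_metric_same_eigenvalues (n : ℕ) (hn : 1 ≤ n)
    (Θ₁ Θ₂ Θ₁d Θ₂d J : Matrix (Fin n) (Fin n) ℝ)
    (h₁ : IsUnit Θ₁) (h₂ : IsUnit Θ₂)
    (hM : Θ₁ᵀ * Θ₁ = Θ₂ᵀ * Θ₂)
    (hMd : Θ₁dᵀ * Θ₁ + Θ₁ᵀ * Θ₁d = Θ₂dᵀ * Θ₂ + Θ₂ᵀ * Θ₂d) :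
    (Θ₂ * Θ₁⁻¹)ᵀ * (Θ₂ * Θ₁⁻¹) = 1 ∧
    (1 / 2 : ℝ) • (((Θ₂d + Θ₂ * J) * Θ₂⁻¹) + ((Θ₂d + Θ₂ * J) * Θ₂⁻¹)ᵀ) =
      (Θ₂ * Θ₁⁻¹) *
        ((1 / 2 : ℝ) • (((Θ₁d + Θ₁ * J) * Θ₁⁻¹) + ((Θ₁d + Θ₁ * J) * Θ₁⁻¹)ᵀ)) *
        (Θ₂ * Θ₁⁻¹)⁻¹ ∧
    ((1 / 2 : ℝ) • (((Θ₁d + Θ₁ * J) * Θ₁⁻¹) + ((Θ₁d + Θ₁ * J) * Θ₁⁻¹)ᵀ)).charpoly =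
      ((1 / 2 : ℝ) • (((Θ₂d + Θ₂ * J) * Θ₂⁻¹) + ((Θ₂d + Θ₂ * J) * Θ₂⁻¹)ᵀ)).charpoly := by
  have hQ := transpose_mul_self_mul_inv h₁ hM
  have hconj : (1 / 2 : ℝ) • (((Θ₂d + Θ₂ * J) * Θ₂⁻¹) + ((Θ₂d + Θ₂ * J) * Θ₂⁻¹)ᵀ) =
      (Θ₂ * Θ₁⁻¹) *
        ((1 / 2 : ℝ) • (((Θ₁d + Θ₁ * J) * Θ₁⁻¹) + ((Θ₁d + Θ₁ * J) * Θ₁⁻¹)ᵀ)) *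
        (Θ₂ * Θ₁⁻¹)⁻¹ := by
    refine eq_conj_of_transpose_mul_mul_eq h₁ h₂ hM ?_
    simp only [Matrix.mul_smul, Matrix.smul_mul,
      transpose_mul_generalizedJacobian_add_transpose_mul h₁,
      transpose_mul_generalizedJacobian_add_transpose_mul h₂, hM, hMd]
  refine ⟨hQ, hconj, ?_⟩
  have hunit : IsUnit (Θ₂ * Θ₁⁻¹) := IsUnit.of_mul_eq_one_right _ hQ
  obtain ⟨u, hu⟩ := hunit
  rw [hconj, ← hu, charpoly_units_conj]
end

section
/- Let A be an n×n real matrix. There exists a symmetric positive definite n×n real matrix P such that AᵀP + PA is negative definite if and only if every eigenvalue μ ∈ ℂ of A (i.e., every element of the spectrum of A viewed as a complex matrix) satisfies Re(μ) < 0. -/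
open Matrix

section BanachAlgebra

variable {E : Type*} [NormedRing E] [NormedAlgebra ℂ E]

theorem exists_norm_pow_lt_one_of_spectrum [CompleteSpace E] [Nontrivial E] {a : E}
    (ha : ∀ z ∈ spectrum ℂ a, ‖z‖ < 1) : ∃ N : ℕ, 0 < N ∧ ‖a ^ N‖ < 1 := by
  have hr : spectralRadius ℂ a < 1 := by
    simpa using spectrum.spectralRadius_lt_of_forall_lt a (r := 1)
      fun z hz ↦ by simpa [← NNReal.coe_lt_coe] using ha z hz
  have hlim := spectrum.pow_nnnorm_pow_one_div_tendsto_nhds_spectralRadius a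
  obtain ⟨N, hN, hpos⟩ :=
    ((hlim.eventually (gt_mem_nhds hr)).and (Filter.eventually_gt_atTop 0)).exists
  refine ⟨N, hpos, ?_⟩
  by_contra! h
  refine hN.not_ge (ENNReal.one_le_rpow ?_ (by positivity))
  exact_mod_cast h

end BanachAlgebra

/-- The Cayley transform `b = (1 + a) (1 - a)⁻¹` moves a spectrum lying in the open left half plane
into the open unit disc. -/
theorem norm_lt_one_of_mem_spectrum_cayley {E : Type*} [Ring E] [Algebra ℂ E] {a b : E}
    (ha : ∀ z ∈ spectrum ℂ a, z.re < 0) (hb : b * (1 - a) = 1 + a) :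
    ∀ z ∈ spectrum ℂ b, ‖z‖ < 1 := by
  intro z hz
  by_contra! hnorm
  have hunit : IsUnit (1 - a) := by
    have h : (1 : ℂ) ∉ spectrum ℂ a := fun h ↦ by simpa using (ha 1 h).trans one_pos
    simpa [spectrum.mem_iff] using h
  have hmul : (algebraMap ℂ E z - b) * (1 - a) = (z - 1) • (1 : E) - (z + 1) • a := by
    rw [sub_mul, hb, ← Algebra.smul_def]
    module
  have hprod : IsUnit ((algebraMap ℂ E z - b) * (1 - a)) := by
    rw [hmul]
    by_cases hz1 : z + 1 = 0
    · have h2 : z - 1 ≠ 0 := fun h ↦ by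
        have : (2 : ℂ) = 0 := by linear_combination hz1 - h
        norm_num at this
      rw [hz1, zero_smul, sub_zero, ← Algebra.algebraMap_eq_smul_one]
      exact (IsUnit.mk0 _ h2).map _
    · have hre : 0 ≤ ((z - 1) / (z + 1)).re := by
        have hsq : 1 ≤ z.re * z.re + z.im * z.im := by
          rw [← Complex.normSq_apply, Complex.normSq_eq_norm_sq]
          nlinarith
        rw [Complex.div_re, ← add_div]
        refine div_nonneg ?_ (Complex.normSq_nonneg _)
        simp only [Complex.sub_re, Complex.add_re, Complex.sub_im, Complex.add_im,
          Complex.one_re, Complex.one_im]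
        nlinarith
      have h : (z - 1) / (z + 1) ∉ spectrum ℂ a := fun h ↦ (ha _ h).not_ge hre
      rw [spectrum.mem_iff, not_not] at h
      have h' := ((IsUnit.mk0 _ hz1).map (algebraMap ℂ E)).mul h
      convert h' using 1
      rw [← Algebra.smul_def, Algebra.algebraMap_eq_smul_one, smul_sub, smul_smul,
        mul_div_cancel₀ _ hz1]
  exact spectrum.mem_iff.mp hz (hunit.mul_right_iff.mp hprod)

namespace Matrix

variable {n : Type*} [Fintype n] [DecidableEq n]

open scoped Matrix.Norms.L2Operator in
theorem dotProduct_mulVec_self_lt_of_norm_map_lt_one {M : Matrix n n ℝ}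
    (hM : ‖Complex.ofRealHom.mapMatrix M‖ < 1) {v : n → ℝ} (hv : v ≠ 0) :
    (M *ᵥ v) ⬝ᵥ (M *ᵥ v) < v ⬝ᵥ v := by
  have hsq : ∀ x : n → ℝ,
      ‖(WithLp.toLp 2 (fun i ↦ (x i : ℂ)) : EuclideanSpace ℂ n)‖ ^ 2 = x ⬝ᵥ x := by
    intro x
    rw [EuclideanSpace.norm_sq_eq]
    simp [dotProduct, sq]
  have hvpos : 0 < ‖(WithLp.toLp 2 (fun i ↦ (v i : ℂ)) : EuclideanSpace ℂ n)‖ := by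
    rw [norm_pos_iff]
    intro h
    apply hv
    ext i
    simpa using congrFun (congrArg WithLp.ofLp h) i
  have hle := l2_opNorm_mulVec (Complex.ofRealHom.mapMatrix M)
    (WithLp.toLp 2 (fun i ↦ (v i : ℂ)))
  have hMv : (Complex.ofRealHom.mapMatrix M) *ᵥ (fun i ↦ (v i : ℂ)) =
      fun i ↦ (((M *ᵥ v) i : ℝ) : ℂ) := by
    ext i
    simp [mulVec, dotProduct]
  simp only [hMv] at hle
  rw [← hsq, ← hsq]
  refine pow_lt_pow_left₀ (hle.trans_lt ?_) (norm_nonneg _) two_ne_zero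
  exact mul_lt_of_lt_one_left hvpos hM

theorem re_neg_of_lyapunov {A P : Matrix n n ℝ} (hsymm : P.IsSymm)
    (hpos : ∀ v : n → ℝ, v ≠ 0 → 0 < v ⬝ᵥ (P *ᵥ v))
    (hneg : ∀ v : n → ℝ, v ≠ 0 → v ⬝ᵥ ((Aᵀ * P + P * A) *ᵥ v) < 0)
    {μ : ℂ} (hμ : μ ∈ spectrum ℂ (Complex.ofRealHom.mapMatrix A)) : μ.re < 0 := by
  rw [spectrum.mem_iff, isUnit_iff_isUnit_det, isUnit_iff_ne_zero, not_not,
    ← exists_mulVec_eq_zero_iff] at hμ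
  obtain ⟨z, hz, hAz⟩ := hμ
  rw [sub_mulVec, sub_eq_zero, Algebra.algebraMap_eq_smul_one, smul_mulVec, one_mulVec] at hAz
  set x : n → ℝ := fun i ↦ (z i).re with hx
  set y : n → ℝ := fun i ↦ (z i).im with hy
  have hAx : A *ᵥ x = μ.re • x - μ.im • y := by
    ext i
    simpa [mulVec, dotProduct, hx, hy] using (congrArg Complex.re (congrFun hAz i)).symm
  have hAy : A *ᵥ y = μ.im • x + μ.re • y := by
    ext i
    have := (congrArg Complex.im (congrFun hAz i)).symm
    simp [mulVec, dotProduct, hx, hy] at this ⊢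
    linarith
  have hcomm : ∀ u v : n → ℝ, u ⬝ᵥ (P *ᵥ v) = v ⬝ᵥ (P *ᵥ u) := fun u v ↦ by
    rw [dotProduct_mulVec, ← mulVec_transpose, hsymm.eq, dotProduct_comm]
  have hL : ∀ v : n → ℝ, v ⬝ᵥ ((Aᵀ * P + P * A) *ᵥ v) = 2 * (v ⬝ᵥ (P *ᵥ (A *ᵥ v))) := by
    intro v
    rw [add_mulVec, dotProduct_add, ← mulVec_mulVec, ← mulVec_mulVec, dotProduct_mulVec v Aᵀ,
      vecMul_transpose, hcomm (A *ᵥ v) v, two_mul]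
  have hsum : x ⬝ᵥ ((Aᵀ * P + P * A) *ᵥ x) + y ⬝ᵥ ((Aᵀ * P + P * A) *ᵥ y) =
      2 * μ.re * (x ⬝ᵥ (P *ᵥ x) + y ⬝ᵥ (P *ᵥ y)) := by
    rw [hL, hL, hAx, hAy]
    simp only [mulVec_sub, mulVec_add, mulVec_smul, dotProduct_sub, dotProduct_add,
      dotProduct_smul, smul_eq_mul, hcomm y x]
    ring
  have hpos' : ∀ v : n → ℝ, 0 ≤ v ⬝ᵥ (P *ᵥ v) := fun v ↦ by
    by_cases h : v = 0
    · simp [h]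
    · exact (hpos v h).le
  have hneg' : ∀ v : n → ℝ, v ⬝ᵥ ((Aᵀ * P + P * A) *ᵥ v) ≤ 0 := fun v ↦ by
    by_cases h : v = 0
    · simp [h]
    · exact (hneg v h).le
  have hxy : x ≠ 0 ∨ y ≠ 0 := by
    by_contra! h
    exact hz (funext fun i ↦ Complex.ext (congrFun h.1 i) (congrFun h.2 i))
  have hlt : x ⬝ᵥ ((Aᵀ * P + P * A) *ᵥ x) + y ⬝ᵥ ((Aᵀ * P + P * A) *ᵥ y) < 0 := by
    rcases hxy with h | h
    · exact add_neg_of_neg_of_nonpos (hneg x h) (hneg' y)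
    · exact add_neg_of_nonpos_of_neg (hneg' x) (hneg y h)
  by_contra! hre
  nlinarith [mul_nonneg hre (add_nonneg (hpos' x) (hpos' y))]

open scoped Matrix.Norms.L2Operator in
theorem exists_lyapunov_of_re_neg {A : Matrix n n ℝ}
    (hA : ∀ μ ∈ spectrum ℂ (Complex.ofRealHom.mapMatrix A), μ.re < 0) :
    ∃ P : Matrix n n ℝ, P.IsSymm ∧
      (∀ v : n → ℝ, v ≠ 0 → 0 < v ⬝ᵥ (P *ᵥ v)) ∧
      (∀ v : n → ℝ, v ≠ 0 → v ⬝ᵥ ((Aᵀ * P + P * A) *ᵥ v) < 0) := by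
  cases isEmpty_or_nonempty n
  · exact ⟨0, isSymm_zero, fun v hv ↦ (hv (Subsingleton.elim _ _)).elim,
      fun v hv ↦ (hv (Subsingleton.elim _ _)).elim⟩
  have hdet : IsUnit (1 - A).det := by
    have h : (1 : ℂ) ∉ spectrum ℂ (Complex.ofRealHom.mapMatrix A) := fun h ↦ by
      simpa using (hA 1 h).trans one_pos
    rw [spectrum.mem_iff, not_not, map_one, ← map_one Complex.ofRealHom.mapMatrix, ← map_sub,
      isUnit_iff_isUnit_det, ← RingHom.map_det] at h
    simpa using h
  set B : Matrix n n ℝ := (1 + A) * (1 - A)⁻¹ with hB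
  have hBA : B * (1 - A) = 1 + A := by rw [hB, mul_assoc, nonsing_inv_mul _ hdet, mul_one]
  have hspec := norm_lt_one_of_mem_spectrum_cayley hA
    (b := Complex.ofRealHom.mapMatrix B)
    (by simpa only [map_mul, map_sub, map_add, map_one] using
      congrArg Complex.ofRealHom.mapMatrix hBA)
  obtain ⟨N, hN, hnorm⟩ := exists_norm_pow_lt_one_of_spectrum hspec
  rw [← map_pow] at hnorm
  set P : Matrix n n ℝ := ∑ k ∈ Finset.range N, (B ^ k)ᵀ * B ^ k with hP
  have hquad : ∀ v : n → ℝ,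
      v ⬝ᵥ (P *ᵥ v) = ∑ k ∈ Finset.range N, (B ^ k *ᵥ v) ⬝ᵥ (B ^ k *ᵥ v) := by
    intro v
    rw [hP, sum_mulVec, dotProduct_sum]
    refine Finset.sum_congr rfl fun k _ ↦ ?_
    rw [← mulVec_mulVec, dotProduct_mulVec, vecMul_transpose]
  have hstep : ∀ v : n → ℝ, v ≠ 0 → (B *ᵥ v) ⬝ᵥ (P *ᵥ (B *ᵥ v)) < v ⬝ᵥ (P *ᵥ v) := by
    intro v hv
    rw [← sub_neg, hquad, hquad, ← Finset.sum_sub_distrib]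
    simp only [mulVec_mulVec, ← pow_succ]
    rw [Finset.sum_range_sub fun k ↦ (B ^ k *ᵥ v) ⬝ᵥ (B ^ k *ᵥ v), sub_neg]
    simpa using dotProduct_mulVec_self_lt_of_norm_map_lt_one hnorm hv
  refine ⟨P, ?_, fun v hv ↦ ?_, fun w hw ↦ ?_⟩
  · simp [IsSymm, hP, transpose_sum]
  · rw [hquad]
    refine Finset.sum_pos' (fun k _ ↦ ?_) ⟨0, Finset.mem_range.mpr hN, ?_⟩
    · exact Finset.sum_nonneg fun i _ ↦ mul_self_nonneg _
    · simpa using (dotProduct_star_self_pos_iff (v := v)).mpr hv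
  · have hne : (1 - A) *ᵥ w ≠ 0 := fun h ↦ hw <|
      eq_zero_of_mulVec_eq_zero hdet.ne_zero h
    have h := hstep _ hne
    rw [mulVec_mulVec, hBA, add_mulVec, sub_mulVec, one_mulVec] at h
    simp only [mulVec_add, mulVec_sub, dotProduct_add, dotProduct_sub, add_dotProduct,
      sub_dotProduct] at h
    rw [add_mulVec, dotProduct_add, ← mulVec_mulVec, ← mulVec_mulVec, dotProduct_mulVec w Aᵀ,
      vecMul_transpose]
    linarith

end Matrix

theorem lyapunov_iff_hurwitz (n : ℕ) (A : Matrix (Fin n) (Fin n) ℝ) :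
    (∃ P : Matrix (Fin n) (Fin n) ℝ, P.IsSymm ∧
      (∀ v : Fin n → ℝ, v ≠ 0 → 0 < v ⬝ᵥ (P *ᵥ v)) ∧
      (∀ v : Fin n → ℝ, v ≠ 0 → v ⬝ᵥ ((Aᵀ * P + P * A) *ᵥ v) < 0)) ↔
    (∀ μ ∈ spectrum ℂ (A.map (Complex.ofReal ·)), μ.re < 0) :=
  ⟨fun ⟨_, hsymm, hpos, hneg⟩ _ hμ ↦ re_neg_of_lyapunov hsymm hpos hneg hμ,
    fun hA ↦ exists_lyapunov_of_re_neg hA⟩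
end

section
/- Let n ≥ 1, let t₀ < t₁ < t₂ < ⋯ be an increasing sequence of reals, let λ̄ ∈ ℝ, let α ∈ [0,1), and let F : ℝ → Mₙ(ℝ) be continuous with vᵀ(F(t) + F(t)ᵀ)v ≤ λ̄‖v‖² for all t and all v ∈ ℝⁿ. Suppose z : [t₀,∞) → ℝⁿ is such that for each i there is a continuous function z̄ᵢ on [tᵢ, tᵢ₊₁], differentiable on (tᵢ, tᵢ₊₁) with z̄ᵢ'(t) = F(t)·z̄ᵢ(t), agreeing with z on [tᵢ, tᵢ₊₁), and such that z(tᵢ₊₁) = Fᵢ · z̄ᵢ(tᵢ₊₁) for some n×n matrix Fᵢ whose largest eigenvalue λ̄ᵢ of FᵢᵀFᵢ satisfies λ̄ᵢ · e^{λ̄(tᵢ₊₁ − tᵢ)} ≤ α. Then for every natural number m, ‖z(t_m)‖² ≤ αᵐ · ‖z(t₀)‖². -/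
open Matrix
open scoped RealInnerProductSpace

theorem toEuclideanCLM_transpose {ι : Type*} [Fintype ι] [DecidableEq ι] (A : Matrix ι ι ℝ) :
    Matrix.toEuclideanCLM (𝕜 := ℝ) Aᵀ =
      ContinuousLinearMap.adjoint (Matrix.toEuclideanCLM (𝕜 := ℝ) A) := by
  rw [← ContinuousLinearMap.star_eq_adjoint, ← map_star, Matrix.star_eq_conjTranspose,
    Matrix.conjTranspose_eq_transpose_of_trivial]

theorem inner_toEuclideanCLM_add_transpose {ι : Type*} [Fintype ι] [DecidableEq ι]
    (A : Matrix ι ι ℝ) (v : EuclideanSpace ℝ ι) :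
    ⟪Matrix.toEuclideanCLM (𝕜 := ℝ) (A + Aᵀ) v, v⟫ =
      2 * ⟪v, Matrix.toEuclideanCLM (𝕜 := ℝ) A v⟫ := by
  rw [map_add, toEuclideanCLM_transpose, _root_.add_apply, inner_add_left,
    ContinuousLinearMap.adjoint_inner_left, real_inner_comm v]
  ring

/-- The Rayleigh quotient of a real symmetric matrix is bounded by any bound on its eigenvalues. -/
theorem inner_toEuclideanCLM_le_of_eigenvalues_le {ι : Type*} [Fintype ι] [DecidableEq ι]
    {A : Matrix ι ι ℝ} (hA : A.IsHermitian) {c : ℝ} (hc : ∀ j, hA.eigenvalues j ≤ c)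
    (v : EuclideanSpace ℝ ι) :
    ⟪Matrix.toEuclideanCLM (𝕜 := ℝ) A v, v⟫ ≤ c * ‖v‖ ^ 2 := by
  set b := hA.eigenvectorBasis
  have hT : Aᵀ = A := by
    rw [← Matrix.conjTranspose_eq_transpose_of_trivial]
    exact hA
  have hb (j : ι) : ⟪Matrix.toEuclideanCLM (𝕜 := ℝ) A v, b j⟫ =
      hA.eigenvalues j * ⟪v, b j⟫ := by
    have he : Matrix.toEuclideanCLM (𝕜 := ℝ) A (b j) = hA.eigenvalues j • b j := by
      ext k
      simpa using congrFun (hA.mulVec_eigenvectorBasis j) k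
    rw [← ContinuousLinearMap.adjoint_inner_right, ← toEuclideanCLM_transpose, hT, he,
      inner_smul_right]
  rw [← b.sum_inner_mul_inner, ← real_inner_self_eq_norm_sq, ← b.sum_inner_mul_inner,
    Finset.mul_sum]
  refine Finset.sum_le_sum fun j _ => ?_
  rw [hb, real_inner_comm v (b j), mul_assoc]
  exact mul_le_mul_of_nonneg_right (hc j) (mul_self_nonneg _)

theorem norm_sq_toEuclideanCLM_le_of_eigenvalues_le {ι : Type*} [Fintype ι] [DecidableEq ι]
    {A : Matrix ι ι ℝ} (hA : (Aᵀ * A).IsHermitian) {c : ℝ} (hc : ∀ j, hA.eigenvalues j ≤ c)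
    (v : EuclideanSpace ℝ ι) :
    ‖Matrix.toEuclideanCLM (𝕜 := ℝ) A v‖ ^ 2 ≤ c * ‖v‖ ^ 2 := by
  refine le_of_eq_of_le ?_ (inner_toEuclideanCLM_le_of_eigenvalues_le hA hc v)
  rw [map_mul, toEuclideanCLM_transpose, mul_apply_eq_comp,
    ContinuousLinearMap.adjoint_inner_left, real_inner_self_eq_norm_sq]

/-- Grönwall-type bound for a flow whose squared norm grows at rate at most `lam`. -/
theorem norm_sq_le_mul_exp_of_inner_deriv_le {E : Type*} [NormedAddCommGroup E]
    [InnerProductSpace ℝ E] {f f' : ℝ → E} {a b lam : ℝ} (hab : a ≤ b)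
    (hf : ContinuousOn f (Set.Icc a b)) (hf' : ∀ s ∈ Set.Ioo a b, HasDerivAt f (f' s) s)
    (hle : ∀ s ∈ Set.Ioo a b, 2 * ⟪f s, f' s⟫ ≤ lam * ‖f s‖ ^ 2) :
    ‖f b‖ ^ 2 ≤ Real.exp (lam * (b - a)) * ‖f a‖ ^ 2 := by
  have hanti : AntitoneOn (fun s => ‖f s‖ ^ 2 * Real.exp (-(lam * (s - a)))) (Set.Icc a b) := by
    refine antitoneOn_of_hasDerivWithinAt_nonpos (convex_Icc a b)
      (f' := fun s => (2 * ⟪f s, f' s⟫ - lam * ‖f s‖ ^ 2) * Real.exp (-(lam * (s - a)))) ?_ ?_ ?_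
    · exact (hf.norm.pow 2).mul (by fun_prop)
    · intro s hs
      rw [interior_Icc] at hs
      have hexp : HasDerivAt (fun s => Real.exp (-(lam * (s - a))))
          (Real.exp (-(lam * (s - a))) * -(lam * 1)) s :=
        (((hasDerivAt_id s).sub_const a).const_mul lam).neg.exp
      refine ((hf' s hs).norm_sq.mul hexp).hasDerivWithinAt.congr_deriv ?_
      ring
    · intro s hs
      rw [interior_Icc] at hs
      exact mul_nonpos_of_nonpos_of_nonneg (sub_nonpos.2 (hle s hs)) (Real.exp_pos _).le
  have h := hanti (Set.left_mem_Icc.2 hab) (Set.right_mem_Icc.2 hab) hab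
  simp only [sub_self, mul_zero, neg_zero, Real.exp_zero, mul_one, Real.exp_neg] at h
  rwa [← div_eq_mul_inv, div_le_iff₀' (Real.exp_pos _)] at h

theorem hybrid_contraction (n : ℕ) (hn : 1 ≤ n) (t : ℕ → ℝ) (ht : StrictMono t)
    (lam α : ℝ) (hα0 : 0 ≤ α) (hα1 : α < 1)
    (F : ℝ → Matrix (Fin n) (Fin n) ℝ) (hFcont : Continuous F)
    (hF : ∀ (s : ℝ) (v : EuclideanSpace ℝ (Fin n)),
      ⟪(Matrix.toEuclideanCLM (𝕜 := ℝ) (F s + (F s)ᵀ)) v, v⟫ ≤ lam * ‖v‖ ^ 2)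
    (z : ℝ → EuclideanSpace ℝ (Fin n))
    (hz : ∀ i : ℕ, ∃ zbar : ℝ → EuclideanSpace ℝ (Fin n),
      ContinuousOn zbar (Set.Icc (t i) (t (i + 1))) ∧
      (∀ s ∈ Set.Ioo (t i) (t (i + 1)),
        HasDerivAt zbar ((Matrix.toEuclideanCLM (𝕜 := ℝ) (F s)) (zbar s)) s) ∧
      (∀ s ∈ Set.Ico (t i) (t (i + 1)), zbar s = z s) ∧
      ∃ G : Matrix (Fin n) (Fin n) ℝ, ∃ hG : (Gᵀ * G).IsHermitian,
        z (t (i + 1)) = (Matrix.toEuclideanCLM (𝕜 := ℝ) G) (zbar (t (i + 1))) ∧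
        ∀ j : Fin n, hG.eigenvalues j * Real.exp (lam * (t (i + 1) - t i)) ≤ α)
    (m : ℕ) :
    ‖z (t m)‖ ^ 2 ≤ α ^ m * ‖z (t 0)‖ ^ 2 := by
  induction m with
  | zero => simp
  | succ i ih =>
    obtain ⟨zbar, hcont, hderiv, heq, G, hG, hjump, heig⟩ := hz i
    have hlt : t i < t (i + 1) := ht i.lt_succ_self
    have hflow : ‖zbar (t (i + 1))‖ ^ 2 ≤
        Real.exp (lam * (t (i + 1) - t i)) * ‖zbar (t i)‖ ^ 2 :=
      norm_sq_le_mul_exp_of_inner_deriv_le hlt.le hcont hderiv fun s _ =>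
        (inner_toEuclideanCLM_add_transpose (F s) (zbar s)).symm.trans_le (hF s (zbar s))
    rw [heq _ (Set.left_mem_Ico.2 hlt)] at hflow
    have hexp := Real.exp_pos (lam * (t (i + 1) - t i))
    calc ‖z (t (i + 1))‖ ^ 2
        ≤ α / Real.exp (lam * (t (i + 1) - t i)) * ‖zbar (t (i + 1))‖ ^ 2 := by
          rw [hjump]
          exact norm_sq_toEuclideanCLM_le_of_eigenvalues_le hG
            (fun j => (le_div_iff₀ hexp).2 (heig j)) _
      _ ≤ α / Real.exp (lam * (t (i + 1) - t i)) *
            (Real.exp (lam * (t (i + 1) - t i)) * ‖z (t i)‖ ^ 2) := by gcongr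
      _ = α * ‖z (t i)‖ ^ 2 := by field_simp
      _ ≤ α * (α ^ i * ‖z (t 0)‖ ^ 2) := by gcongr
      _ = α ^ (i + 1) * ‖z (t 0)‖ ^ 2 := by ring
end

section
/- Let n ≥ 1, a > 0, C ≥ 0, and 0 < Δmin ≤ Δmax. Let t₀ < t₁ < t₂ < ⋯ be reals with Δmin ≤ tᵢ₊₁ − tᵢ ≤ Δmax for all i. Suppose e : [t₀,∞) → ℝⁿ is such that for each i there is a continuous function ēᵢ on [tᵢ, tᵢ₊₁], differentiable on (tᵢ, tᵢ₊₁) with ‖ēᵢ'(t)‖ ≤ C·e^{−a·t}, agreeing with e on [tᵢ, tᵢ₊₁), and such that e(tᵢ₊₁) = ēᵢ(tᵢ₊₁) − (1/(tᵢ₊₁ − tᵢ)) · ∫_{tᵢ}^{tᵢ₊₁} e(s) ds. Then there exists C' ≥ 0 such that ‖e(t)‖ ≤ C'·e^{−a·t} for all t ≥ t₁. -/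
open Matrix MeasureTheory

/-- Mean value inequality on a closed interval, with the derivative bounded in the interior. -/
theorem norm_sub_le_of_hasDerivAt_Ioo {E : Type*} [NormedAddCommGroup E] [NormedSpace ℝ E]
    {f : ℝ → E} {p q K : ℝ} (hpq : p < q) (hK : 0 ≤ K) (hf : ContinuousOn f (Set.Icc p q))
    (hd : ∀ s ∈ Set.Ioo p q, ∃ d : E, HasDerivAt f d s ∧ ‖d‖ ≤ K)
    {x y : ℝ} (hx : x ∈ Set.Icc p q) (hy : y ∈ Set.Icc p q) :
    ‖f x - f y‖ ≤ K * (q - p) := by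
  choose! f' hf' hb using hd
  have hlip : LipschitzOnWith K.toNNReal f (Set.Ioo p q) :=
    (convex_Ioo p q).lipschitzOnWith_of_nnnorm_hasDerivWithin_le
      (fun s hs => (hf' s hs).hasDerivWithinAt)
      (fun s hs => by
        rw [← NNReal.coe_le_coe, coe_nnnorm, Real.coe_toNNReal K hK]
        exact hb s hs)
  have hcl : LipschitzOnWith K.toNNReal f (Set.Icc p q) := by
    rw [← closure_Ioo hpq.ne] at hf ⊢
    exact hlip.closure hf
  have h := hcl.norm_sub_le hx hy
  rw [Real.coe_toNNReal K hK, Real.norm_eq_abs] at h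
  have hxy : |x - y| ≤ q - p :=
    abs_sub_le_iff.2 ⟨by linarith [hx.2, hy.1], by linarith [hx.1, hy.2]⟩
  exact h.trans (mul_le_mul_of_nonneg_left hxy hK)

/-- A vector close to every value of a function is close to the average of that function. -/
theorem norm_sub_average_le {E : Type*} [NormedAddCommGroup E] [NormedSpace ℝ E] [CompleteSpace E]
    {f : ℝ → E} {p q M : ℝ} {c : E} (hpq : p < q) (hf : IntervalIntegrable f volume p q)
    (hM : ∀ s ∈ Set.Ioc p q, ‖c - f s‖ ≤ M) :
    ‖c - (1 / (q - p)) • ∫ s in p..q, f s‖ ≤ M := by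
  have hL : 0 < q - p := sub_pos.2 hpq
  have hc : c - (1 / (q - p)) • ∫ s in p..q, f s
      = (1 / (q - p)) • ∫ s in p..q, (c - f s) := by
    rw [intervalIntegral.integral_sub intervalIntegrable_const hf, intervalIntegral.integral_const,
      smul_sub, smul_smul, one_div_mul_cancel hL.ne', one_smul]
  have hint : ‖∫ s in p..q, (c - f s)‖ ≤ M * |q - p| :=
    intervalIntegral.norm_integral_le_of_norm_le_const fun s hs =>
      hM s (by rwa [Set.uIoc_of_le hpq.le] at hs)
  rw [hc, norm_smul, Real.norm_eq_abs, abs_of_pos (one_div_pos.2 hL), one_div,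
    inv_mul_le_iff₀ hL]
  rw [abs_of_pos hL] at hint
  linarith

theorem velocity_observer_convergence (n : ℕ) (hn : 1 ≤ n)
    (a : ℝ) (ha : 0 < a) (C : ℝ) (hC : 0 ≤ C)
    (Δmin Δmax : ℝ) (hΔmin : 0 < Δmin) (hΔ : Δmin ≤ Δmax)
    (t : ℕ → ℝ) (ht : StrictMono t)
    (hgap : ∀ i : ℕ, Δmin ≤ t (i + 1) - t i ∧ t (i + 1) - t i ≤ Δmax)
    (e : ℝ → EuclideanSpace ℝ (Fin n))
    (he : ∀ i : ℕ, ∃ ebar : ℝ → EuclideanSpace ℝ (Fin n),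
      ContinuousOn ebar (Set.Icc (t i) (t (i + 1))) ∧
      (∀ s ∈ Set.Ioo (t i) (t (i + 1)), ∃ d : EuclideanSpace ℝ (Fin n),
        HasDerivAt ebar d s ∧ ‖d‖ ≤ C * Real.exp (-a * s)) ∧
      (∀ s ∈ Set.Ico (t i) (t (i + 1)), ebar s = e s) ∧
      e (t (i + 1)) = ebar (t (i + 1)) -
        (1 / (t (i + 1) - t i)) • ∫ s in (t i)..(t (i + 1)), e s) :
    ∃ C' : ℝ, 0 ≤ C' ∧ ∀ s : ℝ, t 1 ≤ s → ‖e s‖ ≤ C' * Real.exp (-a * s) := by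
  choose ebar hcont hderiv heq hjump using he
  have hlt (i : ℕ) : t i < t (i + 1) := ht (Nat.lt_succ_self i)
  have hΔmax : 0 ≤ Δmax := hΔmin.le.trans hΔ
  have hosc (i : ℕ) {x y : ℝ} (hx : x ∈ Set.Icc (t i) (t (i + 1)))
      (hy : y ∈ Set.Icc (t i) (t (i + 1))) :
      ‖ebar i x - ebar i y‖ ≤ C * Real.exp (-a * t i) * Δmax := by
    have hK : 0 ≤ C * Real.exp (-a * t i) := by positivity
    refine (norm_sub_le_of_hasDerivAt_Ioo (hlt i) hK (hcont i) (fun s hs => ?_) hx hy).trans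
      (mul_le_mul_of_nonneg_left (hgap i).2 hK)
    obtain ⟨d, hd, hb⟩ := hderiv i s hs
    refine ⟨d, hd, hb.trans (mul_le_mul_of_nonneg_left (Real.exp_le_exp.2 ?_) hC)⟩
    nlinarith [hs.1]
  have hreset (i : ℕ) : ‖e (t (i + 1))‖ ≤ C * Real.exp (-a * t i) * Δmax := by
    have hint : ∫ s in (t i)..(t (i + 1)), e s = ∫ s in (t i)..(t (i + 1)), ebar i s :=
      intervalIntegral.integral_congr_Ioo_of_le (hlt i).le
        fun s hs => (heq i s (Set.Ioo_subset_Ico_self hs)).symm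
    rw [hjump i, hint]
    exact norm_sub_average_le (hlt i) ((hcont i).intervalIntegrable_of_Icc (hlt i).le)
      fun s hs => hosc i (Set.right_mem_Icc.2 (hlt i).le) (Set.Ioc_subset_Icc_self hs)
  have hgrow (i : ℕ) : t 0 + i * Δmin ≤ t i := by
    induction i with
    | zero => simp
    | succ k ih => push_cast; linarith [(hgap k).1]
  refine ⟨2 * C * Δmax * Real.exp (a * (2 * Δmax)), by positivity, fun s hs => ?_⟩
  have hex : ∃ k : ℕ, s < t k := by
    obtain ⟨k, hk⟩ := exists_nat_gt ((s - t 0) / Δmin)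
    rw [div_lt_iff₀ hΔmin] at hk
    exact ⟨k, by linarith [hgrow k]⟩
  obtain ⟨i, hi1, hi2⟩ : ∃ i : ℕ, t (i + 1) ≤ s ∧ s < t (i + 1 + 1) := by
    by_contra! h
    have hall (k : ℕ) : t (k + 1) ≤ s := by
      induction k with
      | zero => simpa using hs
      | succ k ih => exact h k ih
    obtain ⟨k, hk⟩ := hex
    linarith [hall k, hlt k]
  have hleft : t (i + 1) ∈ Set.Ico (t (i + 1)) (t (i + 1 + 1)) := Set.left_mem_Ico.2 (hlt _)
  have hs' : s ∈ Set.Ico (t (i + 1)) (t (i + 1 + 1)) := ⟨hi1, hi2⟩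
  have hdrift := hosc (i + 1) (Set.Ico_subset_Icc_self hs') (Set.Ico_subset_Icc_self hleft)
  rw [heq _ _ hs', heq _ _ hleft] at hdrift
  have hexp0 : Real.exp (-a * t i) ≤ Real.exp (a * (2 * Δmax)) * Real.exp (-a * s) := by
    rw [← Real.exp_add]
    refine Real.exp_le_exp.2 ?_
    nlinarith [(hgap i).2, (hgap (i + 1)).2]
  have hexp1 : Real.exp (-a * t (i + 1)) ≤ Real.exp (-a * t i) :=
    Real.exp_le_exp.2 (by nlinarith [hlt i])
  calc ‖e s‖ = ‖(e s - e (t (i + 1))) + e (t (i + 1))‖ := by rw [sub_add_cancel]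
    _ ≤ C * Real.exp (-a * t (i + 1)) * Δmax + C * Real.exp (-a * t i) * Δmax :=
      norm_add_le_of_le hdrift (hreset i)
    _ ≤ C * Real.exp (-a * t i) * Δmax + C * Real.exp (-a * t i) * Δmax := by gcongr
    _ = 2 * C * Δmax * Real.exp (-a * t i) := by ring
    _ ≤ 2 * C * Δmax * (Real.exp (a * (2 * Δmax)) * Real.exp (-a * s)) := by gcongr
    _ = 2 * C * Δmax * Real.exp (a * (2 * Δmax)) * Real.exp (-a * s) := by ring
end

section
/- Let n ≥ 1, a > 0, C ≥ 0, λ ∈ [0,1), and 0 < Δmin ≤ Δmax. Let t₀ < t₁ < t₂ < ⋯ be reals with Δmin ≤ tᵢ₊₁ − tᵢ ≤ Δmax for all i. Suppose e : [t₀,∞) → ℝⁿ is such that for each i there is a continuous function ēᵢ on [tᵢ, tᵢ₊₁], differentiable on (tᵢ, tᵢ₊₁) with ‖ēᵢ'(t)‖ ≤ C·e^{−a·t}, agreeing with e on [tᵢ, tᵢ₊₁), and such that e(tᵢ₊₁) = Gᵢ · ēᵢ(tᵢ₊₁) for some n×n real matrix Gᵢ with operator norm ‖Gᵢ‖ ≤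 λ. Then there exist C' ≥ 0 and b > 0 such that ‖e(t)‖ ≤ C'·e^{−b·t} for all t ≥ t₀. -/
open Matrix

open Filter Topology in
/-- Mean value inequality on `[a, b]` for a continuous function differentiable on the interior. -/
theorem norm_image_sub_le_of_hasDerivAt_Ioo {E : Type*} [NormedAddCommGroup E] [NormedSpace ℝ E]
    {f : ℝ → E} {a b M : ℝ} (hf : ContinuousOn f (Set.Icc a b))
    (hf' : ∀ x ∈ Set.Ioo a b, ∃ d, HasDerivAt f d x ∧ ‖d‖ ≤ M) :
    ∀ x ∈ Set.Icc a b, ‖f x - f a‖ ≤ M * (x - a) := by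
  intro x hx
  rcases hx.1.eq_or_lt with rfl | hax
  · simp
  have interior : ∀ y ∈ Set.Ioo a x, ‖f x - f y‖ ≤ M * (x - y) := by
    intro y hy
    have hderiv : ∀ z ∈ Set.Ico y x, HasDerivAt f (deriv f z) z ∧ ‖deriv f z‖ ≤ M := by
      intro z hz
      obtain ⟨d, hd, hdM⟩ := hf' z ⟨hy.1.trans_le hz.1, hz.2.trans_le hx.2⟩
      rw [hd.deriv]
      exact ⟨hd, hdM⟩
    exact norm_image_sub_le_of_norm_deriv_right_le_segment
      (hf.mono (Set.Icc_subset_Icc hy.1.le hx.2))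
      (fun z hz => (hderiv z hz).1.hasDerivWithinAt) (fun z hz => (hderiv z hz).2)
      x ⟨hy.2.le, le_rfl⟩
  have hlim : Tendsto f (𝓝[>] a) (𝓝 (f a)) := by
    have h : ContinuousWithinAt f (Set.Ioo a x) a :=
      (hf a ⟨le_rfl, hax.le.trans hx.2⟩).mono fun y hy => ⟨hy.1.le, hy.2.le.trans hx.2⟩
    rwa [ContinuousWithinAt, nhdsWithin_Ioo_eq_nhdsGT hax] at h
  have hid : Tendsto (fun y : ℝ => y) (𝓝[>] a) (𝓝 a) := nhdsWithin_le_nhds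
  refine le_of_tendsto_of_tendsto (tendsto_const_nhds.sub hlim).norm
    ((tendsto_const_nhds.sub hid).const_mul M) ?_
  filter_upwards [Ioo_mem_nhdsGT hax] with y hy using interior y hy

open Filter Topology in
theorem exists_rate_mul_exp_lt_one {a lam : ℝ} (ha : 0 < a) (hlam : lam < 1) (T : ℝ) :
    ∃ b, 0 < b ∧ b ≤ a ∧ lam * Real.exp (b * T) < 1 := by
  have hlim : Tendsto (fun b : ℝ => lam * Real.exp (b * T)) (𝓝[>] 0) (𝓝 lam) := by
    have h : Continuous fun b : ℝ => lam * Real.exp (b * T) := by fun_prop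
    simpa using (h.tendsto 0).mono_left nhdsWithin_le_nhds
  obtain ⟨b, hb1, hb⟩ := ((hlim.eventually_lt_const hlam).and (Ioc_mem_nhdsGT ha)).exists
  exact ⟨b, hb.1, hb.2, hb1⟩

theorem exists_mem_Ico_of_gap_le {t : ℕ → ℝ} {δ : ℝ} (hδ : 0 < δ)
    (hgap : ∀ i, δ ≤ t (i + 1) - t i) {s : ℝ} (hs : t 0 ≤ s) :
    ∃ i, s ∈ Set.Ico (t i) (t (i + 1)) := by
  have hgrow : ∀ i : ℕ, t 0 + i * δ ≤ t i := by
    intro i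
    induction i with
    | zero => simp
    | succ i ih => push_cast; linarith [hgap i]
  obtain ⟨N, hN⟩ := exists_nat_gt ((s - t 0) / δ)
  have hsN : s < t N := by
    rw [div_lt_iff₀ hδ] at hN
    linarith [hgrow N]
  by_contra! h
  have hle : ∀ i, t i ≤ s := by
    intro i
    induction i with
    | zero => exact hs
    | succ i ih => exact not_lt.1 fun hlt => h i ⟨ih, hlt⟩
  exact absurd (hle N) (not_le.2 hsN)

theorem position_observer_convergence (n : ℕ) (hn : 1 ≤ n)
    (a : ℝ) (ha : 0 < a) (C : ℝ) (hC : 0 ≤ C)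
    (lam : ℝ) (hlam0 : 0 ≤ lam) (hlam1 : lam < 1)
    (Δmin Δmax : ℝ) (hΔmin : 0 < Δmin) (hΔ : Δmin ≤ Δmax)
    (t : ℕ → ℝ) (ht : StrictMono t)
    (hgap : ∀ i : ℕ, Δmin ≤ t (i + 1) - t i ∧ t (i + 1) - t i ≤ Δmax)
    (e : ℝ → EuclideanSpace ℝ (Fin n))
    (he : ∀ i : ℕ, ∃ ebar : ℝ → EuclideanSpace ℝ (Fin n),
      ContinuousOn ebar (Set.Icc (t i) (t (i + 1))) ∧
      (∀ s ∈ Set.Ioo (t i) (t (i + 1)), ∃ d : EuclideanSpace ℝ (Fin n),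
        HasDerivAt ebar d s ∧ ‖d‖ ≤ C * Real.exp (-a * s)) ∧
      (∀ s ∈ Set.Ico (t i) (t (i + 1)), ebar s = e s) ∧
      ∃ G : Matrix (Fin n) (Fin n) ℝ,
        ‖Matrix.toEuclideanCLM (𝕜 := ℝ) G‖ ≤ lam ∧
        e (t (i + 1)) = (Matrix.toEuclideanCLM (𝕜 := ℝ) G) (ebar (t (i + 1)))) :
    ∃ C' : ℝ, 0 ≤ C' ∧ ∃ b : ℝ, 0 < b ∧
      ∀ s : ℝ, t 0 ≤ s → ‖e s‖ ≤ C' * Real.exp (-b * s) := by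
  obtain ⟨b, hb, hba, hq⟩ := exists_rate_mul_exp_lt_one ha hlam1 Δmax
  set q := lam * Real.exp (b * Δmax) with hq_def
  have hq0 : 0 ≤ q := by positivity
  have hΔmax : 0 ≤ Δmax := hΔmin.le.trans hΔ
  set D := C * Δmax * Real.exp (-(a - b) * t 0) with hD_def
  have hD : 0 ≤ D := by positivity
  set K := ‖e (t 0)‖ * Real.exp (b * t 0) + q * D / (1 - q) with hK_def
  have h1q : 0 < 1 - q := by linarith
  have hK : 0 ≤ K := by positivity
  have hKstep : q * (K + D) ≤ K := by
    have h1 : q * D / (1 - q) * (1 - q) = q * D := div_mul_cancel₀ _ h1q.ne'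
    have h2 : 0 ≤ ‖e (t 0)‖ * Real.exp (b * t 0) * (1 - q) := by positivity
    have h3 : K * (1 - q) =
        ‖e (t 0)‖ * Real.exp (b * t 0) * (1 - q) + q * D / (1 - q) * (1 - q) := by
      rw [hK_def]; ring
    linarith
  have hforcing : ∀ i, C * Real.exp (-a * t i) * Δmax ≤ D * Real.exp (-b * t i) := by
    intro i
    have hexp : Real.exp (-a * t i) ≤ Real.exp (-(a - b) * t 0) * Real.exp (-b * t i) := by
      rw [← Real.exp_add, Real.exp_le_exp]
      nlinarith [ht.monotone (Nat.zero_le i)]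
    calc C * Real.exp (-a * t i) * Δmax = C * Δmax * Real.exp (-a * t i) := by ring
      _ ≤ C * Δmax * (Real.exp (-(a - b) * t 0) * Real.exp (-b * t i)) := by gcongr
      _ = D * Real.exp (-b * t i) := by rw [hD_def]; ring
  have hflow : ∀ i (f : ℝ → EuclideanSpace ℝ (Fin n)),
      ContinuousOn f (Set.Icc (t i) (t (i + 1))) →
      (∀ s ∈ Set.Ioo (t i) (t (i + 1)), ∃ d, HasDerivAt f d s ∧ ‖d‖ ≤ C * Real.exp (-a * s)) →
      ‖f (t i)‖ ≤ K * Real.exp (-b * t i) →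
      ∀ s ∈ Set.Icc (t i) (t (i + 1)),
        ‖f s‖ ≤ (K + D) * Real.exp (b * Δmax) * Real.exp (-b * s) := by
    intro i f hf hf' hfi s hs
    have hmv := norm_image_sub_le_of_hasDerivAt_Ioo (M := C * Real.exp (-a * t i)) hf
      (fun x hx => by
        obtain ⟨d, hd, hdC⟩ := hf' x hx
        refine ⟨d, hd, hdC.trans ?_⟩
        gcongr C * Real.exp ?_
        nlinarith [hx.1]) s hs
    have hsΔ : s - t i ≤ Δmax := by linarith [hs.2, (hgap i).2]
    have hexp : Real.exp (-b * t i) ≤ Real.exp (b * Δmax) * Real.exp (-b * s) := by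
      rw [← Real.exp_add, Real.exp_le_exp]
      nlinarith
    calc ‖f s‖ ≤ ‖f (t i)‖ + ‖f s - f (t i)‖ := norm_le_norm_add_norm_sub' _ _
      _ ≤ K * Real.exp (-b * t i) + C * Real.exp (-a * t i) * Δmax := by
        gcongr
        exact hmv.trans (by gcongr)
      _ ≤ (K + D) * Real.exp (-b * t i) := by linarith [hforcing i]
      _ ≤ (K + D) * (Real.exp (b * Δmax) * Real.exp (-b * s)) := by gcongr
      _ = (K + D) * Real.exp (b * Δmax) * Real.exp (-b * s) := by ring
  have hnode : ∀ i, ‖e (t i)‖ ≤ K * Real.exp (-b * t i) := by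
    intro i
    induction i with
    | zero =>
      have hcancel : Real.exp (b * t 0) * Real.exp (-b * t 0) = 1 := by
        rw [← Real.exp_add]; simp
      calc ‖e (t 0)‖ = ‖e (t 0)‖ * Real.exp (b * t 0) * Real.exp (-b * t 0) := by
            rw [mul_assoc, hcancel, mul_one]
        _ ≤ K * Real.exp (-b * t 0) := by
            gcongr
            exact le_add_of_nonneg_right (by positivity)
    | succ i ih =>
      have hlt : t i < t (i + 1) := ht (Nat.lt_succ_self i)
      obtain ⟨f, hf, hf', hfe, G, hG, hjump⟩ := he i
      rw [← hfe (t i) ⟨le_rfl, hlt⟩] at ih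
      have hend := hflow i f hf hf' ih (t (i + 1)) ⟨hlt.le, le_rfl⟩
      calc ‖e (t (i + 1))‖ ≤ lam * ‖f (t (i + 1))‖ := by
            rw [hjump]
            exact ContinuousLinearMap.le_of_opNorm_le _ hG _
        _ ≤ lam * ((K + D) * Real.exp (b * Δmax) * Real.exp (-b * t (i + 1))) := by gcongr
        _ = q * (K + D) * Real.exp (-b * t (i + 1)) := by rw [hq_def]; ring
        _ ≤ K * Real.exp (-b * t (i + 1)) := by gcongr
  refine ⟨(K + D) * Real.exp (b * Δmax), by positivity, b, hb, fun s hs => ?_⟩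
  obtain ⟨i, hi⟩ := exists_mem_Ico_of_gap_le hΔmin (fun i => (hgap i).1) hs
  obtain ⟨f, hf, hf', hfe, -⟩ := he i
  have hfi := hnode i
  rw [← hfe (t i) ⟨le_rfl, hi.1.trans_lt hi.2⟩] at hfi
  rw [← hfe s hi]
  exact hflow i f hf hf' hfi s ⟨hi.1, hi.2.le⟩
end

section
/- Let n ≥ 1, let λ̄ > 0, D ≥ 0, N ≥ 0, R ≥ 0, k ∈ ℝ, and let f : ℝⁿ → ℝⁿ be continuously differentiable such that for all y, v ∈ ℝⁿ, ⟨Df(y)v, v⟩ ≤ λ̄‖v‖². Let x, x̂ : [s, s+Δt] → ℝⁿ (Δt > 0) be differentiable with x'(t) = f(x(t)) and x̂'(t) = f(x̂(t)) + d(t) where ‖d(t)‖ ≤ D for all t, and suppose ‖x̂(s) − x(s)‖ ≤ R. Let n₀ ∈ ℝⁿ with ‖n₀‖ ≤ N and define the updated estimate x̂⁺ = x̂(s+Δt) + (k − 1)·(x̂(s+Δt) + n₀ − x(s+Δt)). Then ‖x̂⁺ − x(s+Δt)‖ ≤ |k|·e^{λ̄·Δt}·R + |k|·(D/λ̄)·(e^{λ̄·Δt}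 − 1) + |k−1|·N. -/
open scoped RealInnerProductSpace

section GrowthBound

variable {E : Type*} [NormedAddCommGroup E] [InnerProductSpace ℝ E]

/-- A bound on the symmetric part of the derivative gives a one-sided Lipschitz estimate. -/
theorem inner_sub_le_of_inner_fderiv_le {f : E → E} {c : ℝ} (hf : Differentiable ℝ f)
    (hJ : ∀ y v : E, ⟪fderiv ℝ f y v, v⟫ ≤ c * ‖v‖ ^ 2) (a b : E) :
    ⟪f a - f b, a - b⟫ ≤ c * ‖a - b‖ ^ 2 := by
  have hderiv (y : E) : HasFDerivWithinAt (fun y => ⟪a - b, f y⟫)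
      ((innerSL ℝ (a - b)).comp (fderiv ℝ f y)) Set.univ y :=
    ((innerSL ℝ (a - b)).hasFDerivAt.comp y (hf y).hasFDerivAt).hasFDerivWithinAt
  obtain ⟨z, -, hz⟩ := domain_mvt (fun y _ => hderiv y) convex_univ
    (Set.mem_univ b) (Set.mem_univ a)
  have hmean : ⟪a - b, f a⟫ - ⟪a - b, f b⟫ = ⟪a - b, fderiv ℝ f z (a - b)⟫ := by
    simpa only [ContinuousLinearMap.comp_apply, innerSL_apply_apply] using hz
  rw [real_inner_comm, inner_sub_right, hmean, real_inner_comm]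
  exact hJ z (a - b)

/-- Grönwall's inequality under a one-sided bound on the inner product of a curve with its
derivative. -/
theorem norm_le_gronwallBound_of_inner_deriv_le {e e' : ℝ → E} {δ K D a b : ℝ}
    (hK : 0 ≤ K) (hD : 0 ≤ D)
    (he : ∀ t ∈ Set.Icc a b, HasDerivWithinAt e (e' t) (Set.Icc a b) t) (ha : ‖e a‖ ≤ δ)
    (bound : ∀ t ∈ Set.Ico a b, ⟪e t, e' t⟫ ≤ K * ‖e t‖ ^ 2 + D * ‖e t‖) :
    ∀ t ∈ Set.Icc a b, ‖e t‖ ≤ gronwallBound δ K D (t - a) := by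
  intro t ht
  have regularized : ∀ ε > 0, ‖e t‖ ≤ gronwallBound (δ + ε) K D (t - a) := by
    intro ε hε
    -- `h` is a smooth substitute for the norm, which is not differentiable at zero.
    set h : ℝ → ℝ := fun u => √(‖e u‖ ^ 2 + ε ^ 2)
    have hpos (u : ℝ) : 0 < h u := Real.sqrt_pos.2 (by positivity)
    have norm_le (u : ℝ) : ‖e u‖ ≤ h u := Real.le_sqrt_of_sq_le (by nlinarith [sq_nonneg ε])
    have hderiv : ∀ u ∈ Set.Icc a b,
        HasDerivWithinAt h (⟪e u, e' u⟫ / h u) (Set.Icc a b) u := by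
      intro u hu
      have := (((he u hu).norm_sq).add_const (ε ^ 2)).sqrt (by positivity)
      rwa [mul_div_mul_left _ _ two_ne_zero] at this
    refine (norm_le t).trans (le_gronwallBound_of_liminf_deriv_right_le
      (f' := fun u => ⟪e u, e' u⟫ / h u)
      (fun u hu => (hderiv u hu).continuousWithinAt)
      (fun u hu r hr => ?_) ?_ (fun u hu => ?_) t ht)
    · exact ((hderiv u (Set.Ico_subset_Icc_self hu)).mono_of_mem_nhdsWithin
        (Icc_mem_nhdsGE_of_mem hu)).liminf_right_slope_le hr
    · have := norm_nonneg (e a)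
      exact Real.sqrt_le_iff.2 ⟨by linarith, by nlinarith⟩
    · rw [div_le_iff₀ (hpos u)]
      calc ⟪e u, e' u⟫ ≤ K * ‖e u‖ ^ 2 + D * ‖e u‖ := bound u hu
        _ ≤ K * h u ^ 2 + D * h u := by gcongr <;> exact norm_le u
        _ = (K * h u + D) * h u := by ring
  have hcont : Continuous fun ε => gronwallBound (δ + ε) K D (t - a) := by
    unfold gronwallBound
    split_ifs <;> fun_prop
  have hlim := hcont.continuousWithinAt (s := Set.Ioi 0) (x := 0)
  simpa using ge_of_tendsto hlim (Filter.eventually_of_mem self_mem_nhdsWithin regularized)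

end GrowthBound

theorem observer_disturbance_bound (n : ℕ) (hn : 1 ≤ n)
    (lam : ℝ) (hlam : 0 < lam) (D N R k : ℝ) (hD : 0 ≤ D) (hN : 0 ≤ N) (hR : 0 ≤ R)
    (f : EuclideanSpace ℝ (Fin n) → EuclideanSpace ℝ (Fin n)) (hf : ContDiff ℝ 1 f)
    (hJ : ∀ y v : EuclideanSpace ℝ (Fin n), ⟪(fderiv ℝ f y) v, v⟫ ≤ lam * ‖v‖ ^ 2)
    (s Δt : ℝ) (hΔt : 0 < Δt)
    (x xhat : ℝ → EuclideanSpace ℝ (Fin n)) (d : ℝ → EuclideanSpace ℝ (Fin n))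
    (hx : ∀ τ ∈ Set.Icc s (s + Δt),
      HasDerivWithinAt x (f (x τ)) (Set.Icc s (s + Δt)) τ)
    (hxhat : ∀ τ ∈ Set.Icc s (s + Δt),
      HasDerivWithinAt xhat (f (xhat τ) + d τ) (Set.Icc s (s + Δt)) τ)
    (hd : ∀ τ ∈ Set.Icc s (s + Δt), ‖d τ‖ ≤ D)
    (hinit : ‖xhat s - x s‖ ≤ R)
    (n₀ : EuclideanSpace ℝ (Fin n)) (hn₀ : ‖n₀‖ ≤ N) :
    ‖(xhat (s + Δt) + (k - 1) • (xhat (s + Δt) + n₀ - x (s + Δt))) - x (s + Δt)‖ ≤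
      |k| * Real.exp (lam * Δt) * R +
      |k| * (D / lam) * (Real.exp (lam * Δt) - 1) +
      |k - 1| * N := by
  have herr : ‖xhat (s + Δt) - x (s + Δt)‖ ≤ gronwallBound R lam D (s + Δt - s) := by
    refine norm_le_gronwallBound_of_inner_deriv_le (e := fun t => xhat t - x t) hlam.le hD
      (fun t ht => (hxhat t ht).sub (hx t ht)) hinit (fun t ht => ?_) (s + Δt)
      (Set.right_mem_Icc.2 (by linarith))
    have hlip := inner_sub_le_of_inner_fderiv_le (hf.differentiable one_ne_zero) hJ (xhat t) (x t)
    have hdist : ⟪xhat t - x t, d t⟫ ≤ D * ‖xhat t - x t‖ :=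
      calc ⟪xhat t - x t, d t⟫ ≤ ‖xhat t - x t‖ * ‖d t‖ := real_inner_le_norm _ _
        _ ≤ ‖xhat t - x t‖ * D := by gcongr; exact hd t (Set.Ico_subset_Icc_self ht)
        _ = D * ‖xhat t - x t‖ := mul_comm _ _
    rw [add_sub_right_comm, inner_add_right, real_inner_comm]
    exact add_le_add hlip hdist
  rw [add_sub_cancel_left, gronwallBound_of_K_ne_0 hlam.ne'] at herr
  have hsplit : (xhat (s + Δt) + (k - 1) • (xhat (s + Δt) + n₀ - x (s + Δt))) - x (s + Δt) =
      k • (xhat (s + Δt) - x (s + Δt)) + (k - 1) • n₀ := by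
    module
  calc _ = ‖k • (xhat (s + Δt) - x (s + Δt)) + (k - 1) • n₀‖ := by rw [hsplit]
    _ ≤ |k| * ‖xhat (s + Δt) - x (s + Δt)‖ + |k - 1| * ‖n₀‖ := by
      simpa only [norm_smul, Real.norm_eq_abs] using
        norm_add_le (k • (xhat (s + Δt) - x (s + Δt))) ((k - 1) • n₀)
    _ ≤ |k| * (R * Real.exp (lam * Δt) + D / lam * (Real.exp (lam * Δt) - 1)) +
        |k - 1| * N := by gcongr
    _ = _ := by ring
end

section
/- Let a, b, c, d, x, x̂ ∈ ℝ³ and let J be the 3×3 real matrix whose rows are b − a, c − b, and d − c. Assume J is invertible and let k ∈ ℝ and K = k·J⁻¹. Define m : ℝ³ → ℝ³ by m(z) = (‖z−a‖² − ‖z−b‖², ‖z−b‖² − ‖z−c‖², ‖z−c‖² − ‖z−d‖²), and define the updated estimate x̂⁺ = x̂ − (1/2)·K·(m(x̂) − m(x)) (with K acting on the vector m(x̂) − m(x) by matrix multiplication). Then x̂⁺ − x = (1 − k)·(x̂ − x). -/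
open Matrix

noncomputable def distDiffMeas (a b c d : EuclideanSpace ℝ (Fin 3))
    (z : EuclideanSpace ℝ (Fin 3)) : EuclideanSpace ℝ (Fin 3) :=
  (WithLp.equiv 2 (Fin 3 → ℝ)).symm
    ![‖z - a‖ ^ 2 - ‖z - b‖ ^ 2, ‖z - b‖ ^ 2 - ‖z - c‖ ^ 2, ‖z - c‖ ^ 2 - ‖z - d‖ ^ 2]

theorem norm_sub_sq_sub_norm_sub_sq_sub {E : Type*} [NormedAddCommGroup E] [InnerProductSpace ℝ E]
    (p q y z : E) :
    (‖y - p‖ ^ 2 - ‖y - q‖ ^ 2) - (‖z - p‖ ^ 2 - ‖z - q‖ ^ 2) = 2 * inner ℝ (y - z) (q - p) := by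
  simp only [norm_sub_sq_real, inner_sub_left, inner_sub_right]
  ring

theorem distDiffMeas_sub (a b c d y z : EuclideanSpace ℝ (Fin 3)) :
    distDiffMeas a b c d y - distDiffMeas a b c d z =
      (2 : ℝ) • Matrix.toEuclideanCLM (𝕜 := ℝ)
        (Matrix.of ![fun j => (b - a) j, fun j => (c - b) j, fun j => (d - c) j]) (y - z) := by
  ext i
  fin_cases i <;>
    simp [distDiffMeas, norm_sub_sq_sub_norm_sub_sq_sub, PiLp.inner_apply,
      Matrix.ofLp_toEuclideanCLM, Matrix.mulVec, dotProduct, Fin.sum_univ_three] <;>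
    ring

theorem distance_update_contracts (a b c d x xhat : EuclideanSpace ℝ (Fin 3))
    (J : Matrix (Fin 3) (Fin 3) ℝ)
    (hJ : J = Matrix.of ![fun j => (b - a) j, fun j => (c - b) j, fun j => (d - c) j])
    (hJinv : IsUnit J) (k : ℝ) (K : Matrix (Fin 3) (Fin 3) ℝ) (hK : K = k • J⁻¹) :
    (xhat - (1 / 2 : ℝ) •
        (Matrix.toEuclideanCLM (𝕜 := ℝ) K)
          (distDiffMeas a b c d xhat - distDiffMeas a b c d x)) - x =
      (1 - k) • (xhat - x) := by
  have hinv : K * J = k • (1 : Matrix (Fin 3) (Fin 3) ℝ) := by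
    rw [hK, Matrix.smul_mul, Matrix.nonsing_inv_mul J ((Matrix.isUnit_iff_isUnit_det J).mp hJinv)]
  have hKJ : Matrix.toEuclideanCLM (𝕜 := ℝ) K (Matrix.toEuclideanCLM (𝕜 := ℝ) J (xhat - x)) =
      k • (xhat - x) := by
    rw [← mul_apply_eq_comp, ← map_mul, hinv, map_smul, map_one]
    rfl
  rw [distDiffMeas_sub, ← hJ, map_smul, hKJ]
  module
end

section
/- Let Ω : ℝ → M₄(ℝ) be continuous with Ω(t)ᵀ = −Ω(t) for all t, let α ∈ [0,1), and let 0 < Δmin ≤ Δmax. Let t₀ < t₁ < t₂ < ⋯ be reals with Δmin ≤ tᵢ₊₁ − tᵢ ≤ Δmax. Let q : [t₀,∞) → ℝ⁴ be differentiable with q'(t) = (1/2)·Ω(t)·q(t). Suppose q̂ : [t₀,∞) → ℝ⁴ is such that for each i there is a continuous function q̄ᵢ on [tᵢ, tᵢ₊₁], differentiable on (tᵢ, tᵢ₊₁) with q̄ᵢ'(t) = (1/2)·Ω(t)·q̄ᵢ(t), agreeing with q̂ on [tᵢ, tᵢ₊₁), and such that q̂(tᵢ₊₁) = Fᵢ·q̄ᵢ(tᵢ₊₁)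 + (I − Fᵢ)·q(tᵢ₊₁) for some 4×4 real matrix Fᵢ whose largest eigenvalue of FᵢᵀFᵢ is at most α. Then there exist C ≥ 0 and b > 0 such that ‖q̂(t) − q(t)‖ ≤ C·e^{−b·(t−t₀)}·‖q̂(t₀) − q(t₀)‖ for all t ≥ t₀. -/
open Matrix

theorem Matrix.inner_toEuclideanCLM_left {n : Type*} [Fintype n] [DecidableEq n]
    (A : Matrix n n ℝ) (x y : EuclideanSpace ℝ n) :
    inner ℝ (Matrix.toEuclideanCLM (𝕜 := ℝ) A x) y =
      inner ℝ x (Matrix.toEuclideanCLM (𝕜 := ℝ) Aᵀ y) := by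
  rw [← Matrix.conjTranspose_eq_transpose_of_trivial, ← Matrix.star_eq_conjTranspose, map_star,
    ContinuousLinearMap.star_eq_adjoint, ContinuousLinearMap.adjoint_inner_right]

theorem Matrix.inner_toEuclideanCLM_self_of_transpose_eq_neg {n : Type*} [Fintype n]
    [DecidableEq n] {A : Matrix n n ℝ} (hA : Aᵀ = -A) (x : EuclideanSpace ℝ n) :
    inner ℝ x (Matrix.toEuclideanCLM (𝕜 := ℝ) A x) = 0 := by
  have h := Matrix.inner_toEuclideanCLM_left A x x
  rw [hA, map_neg, _root_.neg_apply, inner_neg_right, real_inner_comm] at h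
  linarith

theorem Matrix.IsHermitian.inner_toEuclideanCLM_self_le {n : Type*} [Fintype n] [DecidableEq n]
    {A : Matrix n n ℝ} (hA : A.IsHermitian) {α : ℝ} (h : ∀ j, hA.eigenvalues j ≤ α)
    (x : EuclideanSpace ℝ n) :
    inner ℝ x (Matrix.toEuclideanCLM (𝕜 := ℝ) A x) ≤ α * ‖x‖ ^ 2 := by
  have hT : Aᵀ = A := by
    rw [← Matrix.conjTranspose_eq_transpose_of_trivial]
    exact hA
  have hb (j : n) : inner ℝ (hA.eigenvectorBasis j) (Matrix.toEuclideanCLM (𝕜 := ℝ) A x) =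
      hA.eigenvalues j * inner ℝ (hA.eigenvectorBasis j) x := by
    have hv : Matrix.toEuclideanCLM (𝕜 := ℝ) A (hA.eigenvectorBasis j) =
        hA.eigenvalues j • hA.eigenvectorBasis j := by
      apply (WithLp.ofLp_injective 2)
      rw [Matrix.ofLp_toEuclideanCLM, hA.mulVec_eigenvectorBasis j]
      rfl
    have := Matrix.inner_toEuclideanCLM_left A (hA.eigenvectorBasis j) x
    rw [hT] at this
    rw [← this, hv, real_inner_smul_left]
  rw [← real_inner_self_eq_norm_sq, ← hA.eigenvectorBasis.sum_inner_mul_inner,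
    ← hA.eigenvectorBasis.sum_inner_mul_inner x x, Finset.mul_sum]
  refine Finset.sum_le_sum fun j _ => ?_
  rw [hb, real_inner_comm]
  nlinarith [mul_le_mul_of_nonneg_right (h j) (sq_nonneg (inner ℝ (hA.eigenvectorBasis j) x))]

theorem Matrix.norm_toEuclideanCLM_sq_le {n : Type*} [Fintype n] [DecidableEq n]
    {F : Matrix n n ℝ} (hH : (Fᵀ * F).IsHermitian) {α : ℝ} (h : ∀ j, hH.eigenvalues j ≤ α)
    (x : EuclideanSpace ℝ n) :
    ‖Matrix.toEuclideanCLM (𝕜 := ℝ) F x‖ ^ 2 ≤ α * ‖x‖ ^ 2 := by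
  have := hH.inner_toEuclideanCLM_self_le h x
  rwa [map_mul, mul_apply_eq_comp, ← Matrix.inner_toEuclideanCLM_left,
    real_inner_self_eq_norm_sq] at this

theorem norm_eq_of_inner_deriv_eq_zero {E : Type*} [NormedAddCommGroup E] [InnerProductSpace ℝ E]
    {f f' : ℝ → E} {a b : ℝ} (hab : a ≤ b) (hf : ContinuousOn f (Set.Icc a b))
    (hf' : ∀ s ∈ Set.Ioo a b, HasDerivAt f (f' s) s)
    (horth : ∀ s ∈ Set.Ioo a b, inner ℝ (f s) (f' s) = 0) : ‖f b‖ = ‖f a‖ := by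
  rcases hab.eq_or_lt with rfl | hab
  · rfl
  obtain ⟨c, hc, hslope⟩ := exists_hasDerivAt_eq_slope (fun s => ‖f s‖ ^ 2)
    (fun s => 2 * inner ℝ (f s) (f' s)) hab (hf.norm.pow 2) (fun s hs => (hf' s hs).norm_sq)
  rw [horth c hc, mul_zero, eq_comm, div_eq_zero_iff] at hslope
  have hne : b - a ≠ 0 := (sub_pos.2 hab).ne'
  have hsq : ‖f b‖ ^ 2 = ‖f a‖ ^ 2 := sub_eq_zero.1 (hslope.resolve_right hne)
  exact (sq_eq_sq₀ (norm_nonneg _) (norm_nonneg _)).1 hsq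

theorem Filter.Tendsto.exists_mem_Ico_succ {t : ℕ → ℝ}
    (htop : Filter.Tendsto t Filter.atTop Filter.atTop) {s : ℝ} (hs : t 0 ≤ s) :
    ∃ i, s ∈ Set.Ico (t i) (t (i + 1)) := by
  classical
  have hex : ∃ n, s < t n := (htop.eventually_gt_atTop s).exists
  obtain ⟨i, hi⟩ : ∃ i, Nat.find hex = i + 1 := Nat.exists_eq_succ_of_ne_zero fun h0 =>
    absurd (Nat.find_spec hex) (by rw [h0]; exact not_lt.2 hs)
  exact ⟨i, not_lt.1 (Nat.find_min hex (by omega)), hi ▸ Nat.find_spec hex⟩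

theorem quaternion_observer_convergence
    (Ω : ℝ → Matrix (Fin 4) (Fin 4) ℝ) (hΩcont : Continuous Ω)
    (hskew : ∀ s : ℝ, (Ω s)ᵀ = -Ω s)
    (α : ℝ) (hα0 : 0 ≤ α) (hα1 : α < 1)
    (Δmin Δmax : ℝ) (hΔmin : 0 < Δmin) (hΔ : Δmin ≤ Δmax)
    (t : ℕ → ℝ) (ht : StrictMono t)
    (hgap : ∀ i : ℕ, Δmin ≤ t (i + 1) - t i ∧ t (i + 1) - t i ≤ Δmax)
    (q : ℝ → EuclideanSpace ℝ (Fin 4))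
    (hq : ∀ s ∈ Set.Ici (t 0), HasDerivWithinAt q
      ((1 / 2 : ℝ) • (Matrix.toEuclideanCLM (𝕜 := ℝ) (Ω s)) (q s)) (Set.Ici (t 0)) s)
    (qhat : ℝ → EuclideanSpace ℝ (Fin 4))
    (hqhat : ∀ i : ℕ, ∃ qbar : ℝ → EuclideanSpace ℝ (Fin 4),
      ContinuousOn qbar (Set.Icc (t i) (t (i + 1))) ∧
      (∀ s ∈ Set.Ioo (t i) (t (i + 1)), HasDerivAt qbar
        ((1 / 2 : ℝ) • (Matrix.toEuclideanCLM (𝕜 := ℝ) (Ω s)) (qbar s)) s) ∧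
      (∀ s ∈ Set.Ico (t i) (t (i + 1)), qbar s = qhat s) ∧
      ∃ F : Matrix (Fin 4) (Fin 4) ℝ, ∃ hH : (Fᵀ * F).IsHermitian,
        (∀ j : Fin 4, hH.eigenvalues j ≤ α) ∧
        qhat (t (i + 1)) = (Matrix.toEuclideanCLM (𝕜 := ℝ) F) (qbar (t (i + 1))) +
          (Matrix.toEuclideanCLM (𝕜 := ℝ) (1 - F)) (q (t (i + 1)))) :
    ∃ C : ℝ, 0 ≤ C ∧ ∃ b : ℝ, 0 < b ∧
      ∀ s : ℝ, t 0 ≤ s →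
        ‖qhat s - q s‖ ≤ C * Real.exp (-b * (s - t 0)) * ‖qhat (t 0) - q (t 0)‖ := by
  have ht0 (i : ℕ) : t 0 ≤ t i := ht.monotone i.zero_le
  have hlower (i : ℕ) : t 0 + i * Δmin ≤ t i := by
    induction i with
    | zero => simp
    | succ i ih => push_cast; linarith [(hgap i).1]
  have hupper (i : ℕ) : t i ≤ t 0 + i * Δmax := by
    induction i with
    | zero => simp
    | succ i ih => push_cast; linarith [(hgap i).2]
  have htop : Filter.Tendsto t Filter.atTop Filter.atTop :=
    Filter.tendsto_atTop_mono hlower (Filter.tendsto_atTop_add_const_left _ _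
      (tendsto_natCast_atTop_atTop.atTop_mul_const hΔmin))
  have hnorm (i : ℕ) : (∀ s ∈ Set.Ico (t i) (t (i + 1)),
      ‖qhat s - q s‖ = ‖qhat (t i) - q (t i)‖) ∧
      ‖qhat (t (i + 1)) - q (t (i + 1))‖ ^ 2 ≤ α * ‖qhat (t i) - q (t i)‖ ^ 2 := by
    obtain ⟨qbar, hcont, hderiv, hagree, F, hH, hev, hjump⟩ := hqhat i
    have hlt : t i < t (i + 1) := ht i.lt_succ_self
    have hconst (s : ℝ) (hs : s ∈ Set.Icc (t i) (t (i + 1))) :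
        ‖qbar s - q s‖ = ‖qhat (t i) - q (t i)‖ := by
      rw [← hagree (t i) ⟨le_rfl, hlt⟩]
      refine norm_eq_of_inner_deriv_eq_zero (f := fun r => qbar r - q r)
        (f' := fun r => (1 / 2 : ℝ) • Matrix.toEuclideanCLM (𝕜 := ℝ) (Ω r) (qbar r - q r))
        hs.1 ?_ ?_ ?_
      · refine (hcont.mono (Set.Icc_subset_Icc_right hs.2)).sub fun r hr => ?_
        exact (hq r ((ht0 i).trans hr.1)).continuousWithinAt.mono
          fun u hu => (ht0 i).trans hu.1
      · intro r hr
        have hr0 : t 0 < r := (ht0 i).trans_lt hr.1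
        rw [map_sub, smul_sub]
        exact (hderiv r ⟨hr.1, hr.2.trans_le hs.2⟩).sub
          ((hq r hr0.le).hasDerivAt (Ici_mem_nhds hr0))
      · intro r _
        rw [real_inner_smul_right,
          Matrix.inner_toEuclideanCLM_self_of_transpose_eq_neg (hskew r), mul_zero]
    refine ⟨fun s hs => ?_, ?_⟩
    · rw [← hagree s hs]
      exact hconst s ⟨hs.1, hs.2.le⟩
    · have herr : qhat (t (i + 1)) - q (t (i + 1)) =
          Matrix.toEuclideanCLM (𝕜 := ℝ) F (qbar (t (i + 1)) - q (t (i + 1))) := by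
        rw [hjump, map_sub, map_sub, map_one, _root_.sub_apply,
          one_apply_eq_self]
        abel
      rw [herr, ← hconst (t (i + 1)) ⟨hlt.le, le_rfl⟩]
      exact Matrix.norm_toEuclideanCLM_sq_le hH hev _
  have hΔmax : 0 < Δmax := hΔmin.trans_le hΔ
  obtain ⟨b, hb, hαb⟩ : ∃ b : ℝ, 0 < b ∧ α ≤ Real.exp (-b * Δmax) ^ 2 := by
    refine ⟨-Real.log ((α + 1) / 2) / (2 * Δmax), ?_, ?_⟩
    · exact div_pos (neg_pos.2 (Real.log_neg (by linarith) (by linarith))) (by linarith)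
    · rw [← Real.exp_nat_mul]
      have : ((2 : ℕ) : ℝ) * (-(-Real.log ((α + 1) / 2) / (2 * Δmax)) * Δmax) =
          Real.log ((α + 1) / 2) := by
        push_cast
        field_simp
      rw [this, Real.exp_log (by linarith)]
      linarith
  have hstep (i : ℕ) : ‖qhat (t i) - q (t i)‖ ≤
      Real.exp (-b * Δmax) ^ i * ‖qhat (t 0) - q (t 0)‖ := by
    induction i with
    | zero => simp
    | succ i ih =>
      have h : ‖qhat (t (i + 1)) - q (t (i + 1))‖ ≤
          Real.exp (-b * Δmax) * ‖qhat (t i) - q (t i)‖ := by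
        refine (sq_le_sq₀ (norm_nonneg _) (by positivity)).1 ?_
        rw [mul_pow]
        exact (hnorm i).2.trans (mul_le_mul_of_nonneg_right hαb (sq_nonneg _))
      calc _ ≤ _ := h
        _ ≤ Real.exp (-b * Δmax) *
            (Real.exp (-b * Δmax) ^ i * ‖qhat (t 0) - q (t 0)‖) := by gcongr
        _ = _ := by ring
  refine ⟨Real.exp (b * Δmax), (Real.exp_pos _).le, b, hb, fun s hs => ?_⟩
  obtain ⟨i, hi⟩ := htop.exists_mem_Ico_succ hs
  rw [(hnorm i).1 s hi]
  refine (hstep i).trans (mul_le_mul_of_nonneg_right ?_ (norm_nonneg _))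
  rw [← Real.exp_nat_mul, ← Real.exp_add, Real.exp_le_exp]
  have hsi : s ≤ t 0 + (i + 1) * Δmax := by
    have := hupper (i + 1)
    push_cast at this
    exact hi.2.le.trans this
  nlinarith [mul_le_mul_of_nonneg_left hsi hb.le]
end
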